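/- arXiv:1111.6658 — 2 statements merged into one kernel-verified Lean document; each statement's English description precedes it below -/
import Mathlib

section
/- Let n ≥ 1, let k and m be nonnegative integers, let h > 0 and M ≥ 0. Let A : 𝒮(ℝⁿ; ℂ) → 𝒮(ℝⁿ; ℂ) be a continuous linear map on Schwartz space such that ‖A g‖_{H^j_h(ℝⁿ)} ≤ M·‖g‖_{H^{j+m}_h(ℝⁿ)} for every integer 0 ≤ j ≤ k and every g ∈ 𝒮(ℝⁿ; ℂ). For f ∈ 𝒮(ℝⁿ⁺¹; ℂ) define Ãf slicewise by (Ãf)(x, y) = (A f(·, y))(x) for x ∈ ℝⁿ, y ∈ ℝ, and assume Ãf ∈ 𝒮(ℝⁿ⁺¹; ℂ). Then there is a constant C depending only on n and k (not on h, M, A or f) such that ‖Ãf‖_{H^k_h(ℝⁿ⁺¹)} ≤ C·M·‖f‖_{H^{k+m}_h(ℝⁿ⁺¹)}. -/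
open MeasureTheory

noncomputable section

/-- Euclidean space `ℝ^d`. -/
abbrev Euc (d : ℕ) := EuclideanSpace ℝ (Fin d)

/-- Directional derivative operator in the direction `v`. -/
def pdir {V : Type*} [NormedAddCommGroup V] [NormedSpace ℝ V]
    (v : V) (u : V → ℂ) : V → ℂ :=
  fun x => fderiv ℝ u x v

/-- Multi-index derivative `∂^α` along the family of directions `dir`. -/
def mderiv {V : Type*} [NormedAddCommGroup V] [NormedSpace ℝ V] {d : ℕ}
    (dir : Fin d → V) (α : Fin d → ℕ) (u : V → ℂ) : V → ℂ :=
  (List.finRange d).foldr (fun j g => (pdir (dir j))^[α j] g) u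

/-- Multi-indices on `Fin d` of total order at most `k`. -/
def multiIdx (d k : ℕ) : Finset (Fin d → ℕ) :=
  (Fintype.piFinset fun _ : Fin d => Finset.range (k + 1)).filter fun α => ∑ i, α i ≤ k

/-- The semiclassical Sobolev norm
`‖u‖_{H^k_h} = (∑_{|α| ≤ k} h^{2|α|} ‖∂^α u‖²_{L²})^{1/2}`. -/
def hsNorm {V : Type*} [NormedAddCommGroup V] [NormedSpace ℝ V] [MeasureSpace V] {d : ℕ}
    (dir : Fin d → V) (h : ℝ) (k : ℕ) (u : V → ℂ) : ℝ :=
  Real.sqrt (∑ α ∈ multiIdx d k, h ^ (2 * ∑ i, α i) * ∫ x, ‖mderiv dir α u x‖ ^ 2)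

/-- The coordinate directions of `ℝⁿ`. -/
def dirBase (n : ℕ) : Fin n → Euc n := fun j => EuclideanSpace.single j 1

/-- The coordinate directions of `ℝⁿ⁺¹ = ℝⁿ × ℝ`. -/
def dirProd (n : ℕ) : Fin (n + 1) → Euc n × ℝ := fun j =>
  if hj : (j : ℕ) < n then (EuclideanSpace.single ⟨(j : ℕ), hj⟩ 1, 0) else (0, 1)

open scoped SchwartzMap LineDeriv Topology
open Filter

section Slice

variable {E : Type} [NormedAddCommGroup E] [NormedSpace ℝ E]

/-- First-order Taylor estimate for a curve whose second derivative is bounded. -/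
lemma norm_taylor_le {F : Type*} [NormedAddCommGroup F] [NormedSpace ℝ F]
    {φ φ' φ'' : ℝ → F} {B : ℝ} (h1 : ∀ s, HasDerivAt φ (φ' s) s)
    (h2 : ∀ s, HasDerivAt φ' (φ'' s) s) (hB : ∀ s, ‖φ'' s‖ ≤ B) (y t : ℝ) :
    ‖φ (y + t) - φ y - t • φ' y‖ ≤ B * t ^ 2 := by
  have hB0 : 0 ≤ B := (norm_nonneg _).trans (hB 0)
  have hlip : ∀ s, ‖φ' (y + s) - φ' y‖ ≤ B * |s| := fun s => by
    simpa using convex_univ.norm_image_sub_le_of_norm_hasDerivWithin_le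
      (fun x _ => (h2 x).hasDerivWithinAt) (fun x _ => hB x) (Set.mem_univ y)
      (Set.mem_univ (y + s))
  have hψ : ∀ s, HasDerivAt (fun s => φ (y + s) - s • φ' y) (φ' (y + s) - φ' y) s := fun s => by
    have h := ((h1 (y + s)).comp_const_add y s).sub ((hasDerivAt_id s).smul_const (φ' y))
    rw [one_smul] at h
    exact h
  have hmv := (convex_closedBall (0 : ℝ) |t|).norm_image_sub_le_of_norm_hasDerivWithin_le
    (C := B * |t|) (fun s _ => (hψ s).hasDerivWithinAt)
    (fun s hs => (hlip s).trans (mul_le_mul_of_nonneg_left (by simpa using hs) hB0))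
    (Metric.mem_closedBall_self (abs_nonneg t)) (y := t) (by simp)
  have heq : φ (y + t) - φ y - t • φ' y
      = φ (y + t) - t • φ' y - (φ (y + 0) - (0 : ℝ) • φ' y) := by
    simp only [add_zero, zero_smul, sub_zero]
    abel
  rw [heq]
  refine hmv.trans (le_of_eq ?_)
  rw [sub_zero, Real.norm_eq_abs, mul_assoc, abs_mul_abs_self, sq]

/-- A Schwartz function on a product is differentiable in the last variable. -/
lemma hasDerivAt_slice {F : Type*} [NormedAddCommGroup F] [NormedSpace ℝ F]
    (g : 𝓢(E × ℝ, F)) (x : E) (y : ℝ) :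
    HasDerivAt (fun s => g (x, s)) (∂_{((0 : E), (1 : ℝ))} g (x, y)) y := by
  have h := (g.hasFDerivAt (x, y)).comp_hasDerivAt y
    ((hasDerivAt_const y x).prodMk (hasDerivAt_id y))
  exact h

/-- The partial differential of a Schwartz function on a product in the first variable. -/
def partialFst {F : Type*} [NormedAddCommGroup F] [NormedSpace ℝ F] (g : 𝓢(E × ℝ, F)) :
    𝓢(E × ℝ, E →L[ℝ] F) :=
  SchwartzMap.postcompCLM
    ((ContinuousLinearMap.compL ℝ E (E × ℝ) F).flip (ContinuousLinearMap.inl ℝ E ℝ))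
    (SchwartzMap.fderivCLM ℝ (E × ℝ) F g)

lemma partialFst_apply {F : Type*} [NormedAddCommGroup F] [NormedSpace ℝ F]
    (g : 𝓢(E × ℝ, F)) (p : E × ℝ) :
    partialFst g p = (fderiv ℝ g p).comp (ContinuousLinearMap.inl ℝ E ℝ) := rfl

lemma hasFDerivAt_slice {F : Type*} [NormedAddCommGroup F] [NormedSpace ℝ F]
    (g : 𝓢(E × ℝ, F)) (x : E) (y : ℝ) :
    HasFDerivAt (fun x => g (x, y)) (partialFst g (x, y)) x := by
  have h := (g.hasFDerivAt (x, y)).comp x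
    ((hasFDerivAt_id (𝕜 := ℝ) x).prodMk (hasFDerivAt_const y x))
  exact h

lemma partialFst_lineDerivOp {F : Type*} [NormedAddCommGroup F] [NormedSpace ℝ F]
    (g : 𝓢(E × ℝ, F)) (v : E × ℝ) :
    partialFst (∂_{v} g) = ∂_{v} (partialFst g) := by
  ext p w
  have hd : HasFDerivAt (fderiv ℝ g) (fderiv ℝ (fderiv ℝ g) p) p :=
    (SchwartzMap.fderivCLM ℝ (E × ℝ) F g).hasFDerivAt p
  have h1 : fderiv ℝ (∂_{v} g : 𝓢(E × ℝ, F)) p = (fderiv ℝ (fderiv ℝ g) p).flip v := by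
    refine HasFDerivAt.fderiv ?_
    have h := hd.clm_apply (hasFDerivAt_const v p)
    rw [ContinuousLinearMap.comp_zero, zero_add] at h
    exact h
  have h2 : fderiv ℝ (partialFst g) p = ((ContinuousLinearMap.compL ℝ E (E × ℝ) F).flip
      (ContinuousLinearMap.inl ℝ E ℝ)).comp (fderiv ℝ (fderiv ℝ g) p) := by
    refine HasFDerivAt.fderiv ?_
    exact (ContinuousLinearMap.hasFDerivAt _).comp p hd
  have hs := ((g.smooth 2).contDiffAt (x := p)).isSymmSndFDerivAt (by simp)
  rw [partialFst_apply, h1, SchwartzMap.lineDerivOp_apply_eq_fderiv, h2]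
  simpa using hs (w, 0) v

/-- The first-order Taylor remainder in the last variable of a Schwartz function on a product is
quadratically small in every Schwartz seminorm of the first variable. -/
lemma exists_taylor_seminorm_le (k l : ℕ) :
    ∀ {F : Type} [NormedAddCommGroup F] [NormedSpace ℝ F] (g : 𝓢(E × ℝ, F)),
      ∃ C : ℝ, ∀ (y t : ℝ) (x : E), ‖x‖ ^ k * ‖iteratedFDeriv ℝ l
        (fun x => g (x, y + t) - g (x, y) - t • ∂_{((0 : E), (1 : ℝ))} g (x, y)) x‖
          ≤ C * t ^ 2 := by
  induction l with
  | zero =>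
    intro F _ _ g
    set v : E × ℝ := (0, 1)
    refine ⟨SchwartzMap.seminorm ℝ k 0 (∂_{v} (∂_{v} g)), fun y t x => ?_⟩
    rw [norm_iteratedFDeriv_zero]
    have h := norm_taylor_le (φ := fun s => ‖x‖ ^ k • g (x, s))
      (fun s => (hasDerivAt_slice g x s).const_smul (‖x‖ ^ k))
      (fun s => (hasDerivAt_slice (∂_{v} g) x s).const_smul (‖x‖ ^ k))
      (B := SchwartzMap.seminorm ℝ k 0 (∂_{v} (∂_{v} g))) (fun s => ?_) y t
    · rwa [smul_comm t, ← smul_sub, ← smul_sub, norm_smul, norm_pow, norm_norm] at h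
    · have h0 := (∂_{v} (∂_{v} g)).le_seminorm ℝ k 0 (x, s)
      rw [norm_iteratedFDeriv_zero] at h0
      rw [norm_smul, norm_pow, norm_norm]
      refine le_trans ?_ h0
      gcongr
      exact le_max_left _ _
  | succ l ih =>
    intro F _ _ g
    obtain ⟨C, hC⟩ := ih (partialFst g)
    refine ⟨C, fun y t x => ?_⟩
    rw [← norm_iteratedFDeriv_fderiv]
    convert hC y t x using 5
    rename_i z
    rw [← partialFst_lineDerivOp]
    exact (((hasFDerivAt_slice g z (y + t)).sub (hasFDerivAt_slice g z y)).sub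
      ((hasFDerivAt_slice (∂_{((0 : E), (1 : ℝ))} g) z y).const_smul t)).fderiv

/-- The slice `x ↦ f (x, y)` of a Schwartz function on a product. -/
def slice (y : ℝ) : 𝓢(E × ℝ, ℂ) →L[ℂ] 𝓢(E, ℂ) :=
  SchwartzMap.compCLM ℂ (g := fun x : E => (x, y))
    (by
      have h : (fun x : E => (x, y)) =
          (ContinuousLinearMap.inl ℝ E ℝ) + fun _ : E => ((0 : E), y) := by
        ext x <;> simp
      rw [h]
      exact (ContinuousLinearMap.hasTemperateGrowth _).add (.const _))
    ⟨1, 1, fun x => by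
      have : ‖x‖ ≤ ‖(x, y)‖ := le_max_left _ _
      simp only [pow_one, one_mul]
      linarith⟩

@[simp]
lemma slice_apply (y : ℝ) (f : 𝓢(E × ℝ, ℂ)) (x : E) : slice y f x = f (x, y) := rfl

lemma tendsto_slice_slope (f : 𝓢(E × ℝ, ℂ)) (y : ℝ) :
    Tendsto (fun t : ℝ => (t⁻¹ : ℂ) • (slice (y + t) f - slice y f)) (𝓝[≠] 0)
      (𝓝 (slice y (∂_{((0 : E), (1 : ℝ))} f))) := by
  rw [(schwartz_withSeminorms ℂ E ℂ).tendsto_nhds]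
  rintro ⟨k, l⟩ ε hε
  obtain ⟨C, hC⟩ := exists_taylor_seminorm_le k l f
  have hC0 : 0 ≤ C := by
    have := hC 0 1 0
    refine le_trans (by positivity) (this.trans_eq (by ring))
  have hlim : Tendsto (fun t : ℝ => C * |t|) (𝓝[≠] 0) (𝓝 0) := by
    have : Tendsto (fun t : ℝ => C * |t|) (𝓝 0) (𝓝 (C * |0|)) :=
      (continuous_const.mul continuous_abs).tendsto 0
    simpa using this.mono_left nhdsWithin_le_nhds
  filter_upwards [hlim.eventually_lt_const hε, self_mem_nhdsWithin] with t ht ht0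
  have ht0 : t ≠ 0 := ht0
  refine lt_of_le_of_lt ?_ ht
  have htC : (t : ℂ) ≠ 0 := by exact_mod_cast ht0
  have heq : (t⁻¹ : ℂ) • (slice (y + t) f - slice y f) - slice y (∂_{((0 : E), (1 : ℝ))} f)
      = (t⁻¹ : ℂ) • (slice (y + t) f - slice y f
        - (t : ℂ) • slice y (∂_{((0 : E), (1 : ℝ))} f)) := by
    rw [smul_sub _ _ ((t : ℂ) • _), inv_smul_smul₀ htC]
  rw [heq, map_smul_eq_mul, norm_inv, Complex.norm_real, Real.norm_eq_abs,
    inv_mul_le_iff₀ (abs_pos.2 ht0)]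
  refine SchwartzMap.seminorm_le_bound ℂ k l _ (by positivity) fun x => ?_
  refine (hC y t x).trans_eq ?_
  rw [← sq_abs]
  ring

/-- A continuous linear operator on Schwartz space, applied slicewise, commutes with
differentiation in the last variable. -/
lemma slicewise_lineDerivOp (A : 𝓢(E, ℂ) →L[ℂ] 𝓢(E, ℂ)) {f Af : 𝓢(E × ℝ, ℂ)}
    (h : ∀ y, slice y Af = A (slice y f)) (y : ℝ) :
    slice y (∂_{((0 : E), (1 : ℝ))} Af) = A (slice y (∂_{((0 : E), (1 : ℝ))} f)) := by
  refine tendsto_nhds_unique (tendsto_slice_slope Af y) ?_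
  refine ((A.continuous.tendsto _).comp (tendsto_slice_slope f y)).congr fun t => ?_
  simp [h]

end Slice

section Derivatives

variable {V : Type*} [NormedAddCommGroup V] [NormedSpace ℝ V]

/-- The multi-index derivative `mderiv` as a map on Schwartz space. -/
def schwartzMderiv {d : ℕ} (dir : Fin d → V) (α : Fin d → ℕ) (u : 𝓢(V, ℂ)) : 𝓢(V, ℂ) :=
  (List.finRange d).foldr (fun j g => (fun w : 𝓢(V, ℂ) => ∂_{dir j} w)^[α j] g) u

lemma iterate_pdir_coe (v : V) (a : ℕ) (u : 𝓢(V, ℂ)) :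
    (pdir v)^[a] u = ⇑((fun w : 𝓢(V, ℂ) => ∂_{v} w)^[a] u) :=
  (Function.Semiconj.iterate_right (f := fun w : 𝓢(V, ℂ) => (w : V → ℂ))
    (ga := fun w : 𝓢(V, ℂ) => ∂_{v} w) (gb := pdir v) (fun _ => rfl) a u).symm

lemma mderiv_coe {d : ℕ} (dir : Fin d → V) (α : Fin d → ℕ) (u : 𝓢(V, ℂ)) :
    mderiv dir α u = ⇑(schwartzMderiv dir α u) := by
  unfold mderiv schwartzMderiv
  induction List.finRange d with
  | nil => rfl
  | cons j L ih => rw [List.foldr_cons, List.foldr_cons, ih, iterate_pdir_coe]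

lemma integrable_norm_mderiv_sq [MeasurableSpace V] [BorelSpace V] [SecondCountableTopology V]
    {d : ℕ} (dir : Fin d → V) (α : Fin d → ℕ) (u : 𝓢(V, ℂ)) (μ : Measure V)
    [μ.HasTemperateGrowth] : Integrable (fun x => ‖mderiv dir α u x‖ ^ 2) μ := by
  rw [mderiv_coe]
  exact ((schwartzMderiv dir α u).memLp 2 μ).integrable_norm_pow (by simp)

end Derivatives

lemma slice_lineDerivOp {E : Type} [NormedAddCommGroup E] [NormedSpace ℝ E] (v : E) (y : ℝ)
    (g : 𝓢(E × ℝ, ℂ)) : slice y (∂_{(v, (0 : ℝ))} g) = ∂_{v} (slice y g) := by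
  ext x
  rw [SchwartzMap.lineDerivOp_apply_eq_fderiv]
  change _ = fderiv ℝ (fun x => g (x, y)) x v
  rw [(hasFDerivAt_slice g x y).fderiv]
  simp [partialFst_apply, SchwartzMap.lineDerivOp_apply_eq_fderiv]

/-- The `a`-th derivative in the last variable. -/
def lastDeriv {E : Type} [NormedAddCommGroup E] [NormedSpace ℝ E] (a : ℕ) (f : 𝓢(E × ℝ, ℂ)) :
    𝓢(E × ℝ, ℂ) :=
  (fun w : 𝓢(E × ℝ, ℂ) => ∂_{((0 : E), (1 : ℝ))} w)^[a] f

lemma slicewise_lastDeriv {E : Type} [NormedAddCommGroup E] [NormedSpace ℝ E]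
    (A : 𝓢(E, ℂ) →L[ℂ] 𝓢(E, ℂ)) {f Af : 𝓢(E × ℝ, ℂ)}
    (h : ∀ y, slice y Af = A (slice y f)) (a : ℕ) (y : ℝ) :
    slice y (lastDeriv a Af) = A (slice y (lastDeriv a f)) := by
  induction a generalizing y with
  | zero => exact h y
  | succ a ih =>
    simp only [lastDeriv, Function.iterate_succ_apply'] at ih ⊢
    exact slicewise_lineDerivOp A ih y

lemma slice_schwartzMderiv {n : ℕ} (α : Fin (n + 1) → ℕ) (f : 𝓢(Euc n × ℝ, ℂ)) (y : ℝ) :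
    slice y (schwartzMderiv (dirProd n) α f) =
      schwartzMderiv (dirBase n) (Fin.init α) (slice y (lastDeriv (α (Fin.last n)) f)) := by
  have hlast : dirProd n (Fin.last n) = (0, 1) := by simp [dirProd]
  have hcast : ∀ j : Fin n, dirProd n j.castSucc = (dirBase n j, 0) := fun j => by
    simp [dirProd, dirBase]
  unfold schwartzMderiv
  rw [List.finRange_succ_last, List.foldr_append, List.foldr_map, List.foldr_cons, List.foldr_nil,
    hlast]
  change slice y (List.foldr _ (lastDeriv (α (Fin.last n)) f) _) = _
  induction List.finRange n with
  | nil => rfl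
  | cons j L ih =>
    rw [List.foldr_cons, List.foldr_cons, ← ih, hcast]
    exact Function.Semiconj.iterate_right (f := slice y)
      (ga := fun w : 𝓢(Euc n × ℝ, ℂ) => ∂_{(dirBase n j, (0 : ℝ))} w)
      (gb := fun w : 𝓢(Euc n, ℂ) => ∂_{dirBase n j} w)
      (slice_lineDerivOp (dirBase n j) y) _ _

lemma mderiv_dirProd {n : ℕ} (α : Fin (n + 1) → ℕ) (f : 𝓢(Euc n × ℝ, ℂ)) (x : Euc n) (y : ℝ) :
    mderiv (dirProd n) α f (x, y) =
      mderiv (dirBase n) (Fin.init α) (slice y (lastDeriv (α (Fin.last n)) f)) x := by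
  rw [mderiv_coe, mderiv_coe, ← slice_schwartzMderiv, slice_apply]

lemma mem_multiIdx {d k : ℕ} {α : Fin d → ℕ} : α ∈ multiIdx d k ↔ ∑ i, α i ≤ k := by
  simp only [multiIdx, Finset.mem_filter, Fintype.mem_piFinset, Finset.mem_range,
    and_iff_right_iff_imp]
  intro h i
  have := Finset.single_le_sum (f := α) (fun _ _ => Nat.zero_le _) (Finset.mem_univ i)
  omega

lemma sum_multiIdx_succ (n k : ℕ) (F : (Fin (n + 1) → ℕ) → ℝ) :
    ∑ α ∈ multiIdx (n + 1) k, F α =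
      ∑ a ∈ Finset.range (k + 1), ∑ β ∈ multiIdx n (k - a), F (Fin.snoc β a) := by
  rw [Finset.sum_sigma']
  refine Finset.sum_bij' (fun α _ => ⟨α (Fin.last n), Fin.init α⟩) (fun p _ => Fin.snoc p.2 p.1)
    ?_ ?_ ?_ ?_ ?_
  · intro α hα
    rw [mem_multiIdx, Fin.sum_univ_castSucc] at hα
    simp only [Finset.mem_sigma, Finset.mem_range, mem_multiIdx, Fin.init]
    omega
  · rintro ⟨a, β⟩ h
    simp only [Finset.mem_sigma, Finset.mem_range, mem_multiIdx] at h
    simp only [mem_multiIdx, Fin.sum_univ_castSucc, Fin.snoc_castSucc, Fin.snoc_last]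
    omega
  · intro α _
    simp
  · rintro ⟨a, β⟩ _
    simp
  · intro α _
    simp

lemma hsNorm_sq {V : Type*} [NormedAddCommGroup V] [NormedSpace ℝ V] [MeasureSpace V] {d : ℕ}
    (dir : Fin d → V) {h : ℝ} (hh : 0 ≤ h) (k : ℕ) (u : V → ℂ) :
    hsNorm dir h k u ^ 2 =
      ∑ α ∈ multiIdx d k, h ^ (2 * ∑ i, α i) * ∫ x, ‖mderiv dir α u x‖ ^ 2 :=
  Real.sq_sqrt (Finset.sum_nonneg fun _ _ =>
    mul_nonneg (pow_nonneg hh _) (integral_nonneg fun _ => sq_nonneg _))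

lemma integrable_norm_mderiv_slice_sq {n : ℕ} (β : Fin n → ℕ) (a : ℕ) (f : 𝓢(Euc n × ℝ, ℂ)) :
    Integrable (fun z : Euc n × ℝ => ‖mderiv (dirBase n) β (slice z.2 (lastDeriv a f)) z.1‖ ^ 2)
      ((volume : Measure (Euc n)).prod (volume : Measure ℝ)) := by
  have h := integrable_norm_mderiv_sq (dirProd n) (Fin.snoc β a) f
    ((volume : Measure (Euc n)).prod (volume : Measure ℝ))
  refine h.congr (ae_of_all _ fun z => ?_)
  obtain ⟨x, y⟩ := z
  simp [mderiv_dirProd]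

lemma integrable_hsNorm_slice_sq {n : ℕ} {h : ℝ} (hh : 0 ≤ h) (j a : ℕ) (f : 𝓢(Euc n × ℝ, ℂ)) :
    Integrable fun y => hsNorm (dirBase n) h j (slice y (lastDeriv a f)) ^ 2 := by
  simp only [hsNorm_sq _ hh]
  exact integrable_finsetSum _ fun β _ =>
    ((integrable_norm_mderiv_slice_sq β a f).integral_prod_right).const_mul _

lemma hsNorm_dirProd_sq {n : ℕ} {h : ℝ} (hh : 0 ≤ h) (k : ℕ) (f : 𝓢(Euc n × ℝ, ℂ)) :
    hsNorm (dirProd n) h k f ^ 2 = ∑ a ∈ Finset.range (k + 1),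
      h ^ (2 * a) * ∫ y, hsNorm (dirBase n) h (k - a) (slice y (lastDeriv a f)) ^ 2 := by
  rw [hsNorm_sq _ hh, sum_multiIdx_succ]
  refine Finset.sum_congr rfl fun a _ => ?_
  simp only [hsNorm_sq _ hh]
  rw [integral_finsetSum _ fun β _ =>
    ((integrable_norm_mderiv_slice_sq β a f).integral_prod_right).const_mul _, Finset.mul_sum]
  refine Finset.sum_congr rfl fun β _ => ?_
  rw [integral_const_mul, Fin.sum_univ_castSucc, Measure.volume_eq_prod,
    integral_prod_symm _ (integrable_norm_mderiv_sq _ _ f _)]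
  simp only [mderiv_dirProd, Fin.snoc_castSucc, Fin.snoc_last, Fin.init_snoc]
  ring

/-- A pseudodifferential-type operator of order `m` on `ℝⁿ`, acting slicewise on
`ℝⁿ⁺¹ = ℝⁿ × ℝ`, is bounded from `H^{k+m}_h(ℝⁿ⁺¹)` to `H^k_h(ℝⁿ⁺¹)` with a constant
depending only on `n` and `k`. -/
theorem stmt3 (n k : ℕ) (hn : 1 ≤ n) :
    ∃ C > (0 : ℝ), ∀ (m : ℕ) (h M : ℝ), 0 < h → 0 ≤ M →
      ∀ A : SchwartzMap (Euc n) ℂ →L[ℂ] SchwartzMap (Euc n) ℂ,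
        (∀ j : ℕ, j ≤ k → ∀ g : SchwartzMap (Euc n) ℂ,
          hsNorm (dirBase n) h j (⇑(A g)) ≤ M * hsNorm (dirBase n) h (j + m) (⇑g)) →
      ∀ f Af : SchwartzMap (Euc n × ℝ) ℂ,
        (∀ y : ℝ, ∃ fy : SchwartzMap (Euc n) ℂ,
          (∀ x : Euc n, fy x = f (x, y)) ∧ (∀ x : Euc n, Af (x, y) = A fy x)) →
        hsNorm (dirProd n) h k (⇑Af) ≤ C * M * hsNorm (dirProd n) h (k + m) (⇑f) := by
  refine ⟨1, one_pos, fun m h M hh hM A hA f Af hf => ?_⟩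
  have hslice : ∀ y, slice y Af = A (slice y f) := fun y => by
    obtain ⟨fy, hfy, hAfy⟩ := hf y
    have heq : fy = slice y f := by
      ext x
      exact hfy x
    subst heq
    ext x
    exact hAfy x
  rw [one_mul]
  refine le_of_sq_le_sq ?_ (mul_nonneg hM (Real.sqrt_nonneg _))
  rw [mul_pow, hsNorm_dirProd_sq hh.le, hsNorm_dirProd_sq hh.le, Finset.mul_sum]
  have hterm : ∀ a, 0 ≤ M ^ 2 * (h ^ (2 * a) *
      ∫ y, hsNorm (dirBase n) h (k + m - a) (slice y (lastDeriv a f)) ^ 2) := fun a =>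
    mul_nonneg (sq_nonneg M) (mul_nonneg (pow_nonneg hh.le _) (integral_nonneg fun _ =>
      sq_nonneg _))
  refine le_trans (Finset.sum_le_sum fun a ha => ?_)
    (Finset.sum_le_sum_of_subset_of_nonneg (Finset.range_mono (by omega : k + 1 ≤ k + m + 1))
      fun a _ _ => hterm a)
  have hak : k + m - a = k - a + m := by
    have := Finset.mem_range.1 ha
    omega
  rw [mul_left_comm, hak]
  refine mul_le_mul_of_nonneg_left ?_ (pow_nonneg hh.le _)
  rw [← integral_const_mul]
  refine integral_mono (integrable_hsNorm_slice_sq hh.le _ _ _)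
    ((integrable_hsNorm_slice_sq hh.le _ _ _).const_mul _) fun y => ?_
  simp only [slicewise_lastDeriv A hslice, ← mul_pow]
  exact pow_le_pow_left₀ (Real.sqrt_nonneg _) (hA (k - a) (Nat.sub_le _ _) _) 2
end
end

section
/- Let d ≥ 1, let U ⊆ ℝ^d be open, and let a₀, a₁ : U → ℂ be smooth functions such that a₁ vanishes nowhere on U and ⟨∇a₀, ∇a₀⟩ + a₁² = 0 on U. Then there exists a unique sequence of smooth functions a_j : U → ℂ, j ≥ 2, such that for every integer m ≥ 1, Σ_{j+k=m} ⟨∇a_j, ∇a_k⟩ + Σ_{j+k=m+2} j·k·a_j·a_k = 0 on U, where both sums range over pairs of nonnegative integers (j,k) with the indicated sum. -/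
open Set

noncomputable section

/-- Complex-bilinear dot product of gradients: `⟨∇a, ∇b⟩ = ∑ᵢ (∂ᵢa)(∂ᵢb)`. -/
def cdot {d : ℕ} (a b : Euc d → ℂ) (x : Euc d) : ℂ :=
  ∑ i, fderiv ℝ a x (EuclideanSpace.single i 1) * fderiv ℝ b x (EuclideanSpace.single i 1)

lemma ContDiffOn.cdot {d : ℕ} {U : Set (Euc d)} (hU : IsOpen U) {a b : Euc d → ℂ}
    (ha : ContDiffOn ℝ (⊤ : ℕ∞) a U) (hb : ContDiffOn ℝ (⊤ : ℕ∞) b U) :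
    ContDiffOn ℝ (⊤ : ℕ∞) (_root_.cdot a b) U := by
  unfold _root_.cdot
  refine ContDiffOn.sum fun i _ => ContDiffOn.mul ?_ ?_
  · exact (ha.fderiv_of_isOpen hU le_rfl).clm_apply contDiffOn_const
  · exact (hb.fderiv_of_isOpen hU le_rfl).clm_apply contDiffOn_const

lemma cdot_eqOn {d : ℕ} {U : Set (Euc d)} (hU : IsOpen U) {a a' b b' : Euc d → ℂ}
    (ha : EqOn a a' U) (hb : EqOn b b' U) : EqOn (cdot a b) (cdot a' b') U := by
  intro x hx
  unfold cdot
  rw [(ha.eventuallyEq_of_mem (hU.mem_nhds hx)).fderiv_eq,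
    (hb.eventuallyEq_of_mem (hU.mem_nhds hx)).fderiv_eq]

/-- The part of the transport equation of order `n + 1` which involves only the coefficients
of index at most `n + 1`. -/
def transportSource {d : ℕ} (n : ℕ) (a : ℕ → Euc d → ℂ) (x : Euc d) : ℂ :=
  (∑ j ∈ Finset.range (n + 2), cdot (a j) (a (n + 1 - j)) x) +
    ∑ i ∈ Finset.range n,
      ((i + 2 : ℕ) : ℂ) * ((n + 1 - i : ℕ) : ℂ) * a (i + 2) x * a (n + 1 - i) x

lemma transport_eq_source_add {d : ℕ} (n : ℕ) (a : ℕ → Euc d → ℂ) (x : Euc d) :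
    (∑ j ∈ Finset.range (n + 1 + 1), cdot (a j) (a (n + 1 - j)) x) +
      (∑ j ∈ Finset.range (n + 1 + 3),
        (j : ℂ) * ((n + 1 + 2 - j : ℕ) : ℂ) * a j x * a (n + 1 + 2 - j) x) =
      transportSource n a x + 2 * ((n : ℂ) + 2) * a 1 x * a (n + 2) x := by
  have key : ∀ f : ℕ → ℂ, ∑ j ∈ Finset.range (n + 1 + 3), f j =
      (∑ i ∈ Finset.range n, f (i + 2)) + f 0 + f 1 + f (n + 2) + f (n + 3) := by
    intro f
    rw [Finset.sum_range_succ, Finset.sum_range_succ, Finset.sum_range_succ',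
      Finset.sum_range_succ']
    ring
  have h1 : n + 1 + 2 - (n + 2) = 1 := by omega
  have h2 : n + 1 + 2 - (n + 3) = 0 := by omega
  have h3 : n + 1 + 2 - 1 = n + 2 := by omega
  have h4 : ∀ i, n + 1 + 2 - (i + 2) = n + 1 - i := by omega
  rw [key, transportSource, h1, h2, h3]
  simp only [h4]
  push_cast
  ring

lemma transportSource_eqOn {d : ℕ} {U : Set (Euc d)} (hU : IsOpen U) (n : ℕ)
    {a b : ℕ → Euc d → ℂ} (h : ∀ j < n + 2, EqOn (a j) (b j) U) :
    EqOn (transportSource n a) (transportSource n b) U := by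
  intro x hx
  unfold transportSource
  congr 1
  · refine Finset.sum_congr rfl fun j hj => ?_
    have := Finset.mem_range.1 hj
    exact cdot_eqOn hU (h _ (by omega)) (h _ (by omega)) hx
  · refine Finset.sum_congr rfl fun i hi => ?_
    have := Finset.mem_range.1 hi
    rw [h (i + 2) (by omega) hx, h (n + 1 - i) (by omega) hx]

lemma ContDiffOn.transportSource {d : ℕ} {U : Set (Euc d)} (hU : IsOpen U) (n : ℕ)
    {a : ℕ → Euc d → ℂ} (h : ∀ j < n + 2, ContDiffOn ℝ (⊤ : ℕ∞) (a j) U) :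
    ContDiffOn ℝ (⊤ : ℕ∞) (_root_.transportSource n a) U := by
  unfold _root_.transportSource
  refine ContDiffOn.add (ContDiffOn.sum fun j hj => ?_) (ContDiffOn.sum fun i hi => ?_)
  · have := Finset.mem_range.1 hj
    exact ContDiffOn.cdot hU (h _ (by omega)) (h _ (by omega))
  · have := Finset.mem_range.1 hi
    exact (contDiffOn_const.mul (h _ (by omega))).mul (h _ (by omega))

/-- The coefficients obtained by solving the transport equations successively. -/
def transportCoeff {d : ℕ} (a₀ a₁ : Euc d → ℂ) : ℕ → Euc d → ℂ
  | 0 => a₀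
  | 1 => a₁
  | n + 2 => fun x =>
      -transportSource n (fun j => if j < n + 2 then transportCoeff a₀ a₁ j else 0) x /
        (2 * ((n : ℂ) + 2) * a₁ x)

lemma transportCoeff_add_two {d : ℕ} {U : Set (Euc d)} (hU : IsOpen U) (a₀ a₁ : Euc d → ℂ)
    (n : ℕ) : EqOn (transportCoeff a₀ a₁ (n + 2)) (fun x =>
      -transportSource n (transportCoeff a₀ a₁) x / (2 * ((n : ℂ) + 2) * a₁ x)) U := by
  intro x hx
  rw [transportCoeff]
  have := transportSource_eqOn hU n
    (a := fun j => if j < n + 2 then transportCoeff a₀ a₁ j else 0)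
    (b := transportCoeff a₀ a₁) (fun j hj => by simp [hj, EqOn]) hx
  simp only [this]

/-- The formal power series construction for the phase `ℓ` (Section 7): given the first
two coefficients with `a₁` nonvanishing and the order-zero equation, the transport
recursion `∑_{j+k=m} ⟨∇a_j, ∇a_k⟩ + ∑_{j+k=m+2} jk a_j a_k = 0` for all `m ≥ 1`
admits a unique solution by smooth functions on `U`. -/
theorem stmt13 (d : ℕ) (hd : 1 ≤ d) (U : Set (Euc d)) (hU : IsOpen U)
    (a₀ a₁ : Euc d → ℂ)
    (ha₀ : ContDiffOn ℝ (⊤ : ℕ∞) a₀ U) (ha₁ : ContDiffOn ℝ (⊤ : ℕ∞) a₁ U)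
    (ha₁ne : ∀ x ∈ U, a₁ x ≠ 0)
    (heq0 : ∀ x ∈ U, cdot a₀ a₀ x + (a₁ x) ^ 2 = 0) :
    ∃ a : ℕ → Euc d → ℂ,
      (a 0 = a₀ ∧ a 1 = a₁ ∧
        (∀ j : ℕ, 2 ≤ j → ContDiffOn ℝ (⊤ : ℕ∞) (a j) U) ∧
        (∀ m : ℕ, 1 ≤ m → ∀ x ∈ U,
          (∑ j ∈ Finset.range (m + 1), cdot (a j) (a (m - j)) x) +
            (∑ j ∈ Finset.range (m + 3),
              (j : ℂ) * ((m + 2 - j : ℕ) : ℂ) * a j x * a (m + 2 - j) x) = 0)) ∧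
      (∀ b : ℕ → Euc d → ℂ, b 0 = a₀ → b 1 = a₁ →
        (∀ j : ℕ, 2 ≤ j → ContDiffOn ℝ (⊤ : ℕ∞) (b j) U) →
        (∀ m : ℕ, 1 ≤ m → ∀ x ∈ U,
          (∑ j ∈ Finset.range (m + 1), cdot (b j) (b (m - j)) x) +
            (∑ j ∈ Finset.range (m + 3),
              (j : ℂ) * ((m + 2 - j : ℕ) : ℂ) * b j x * b (m + 2 - j) x) = 0) →
        ∀ j : ℕ, 2 ≤ j → Set.EqOn (a j) (b j) U) := by
  have h0 : transportCoeff a₀ a₁ 0 = a₀ := by rw [transportCoeff]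
  have h1 : transportCoeff a₀ a₁ 1 = a₁ := by rw [transportCoeff]
  have hne : ∀ (n : ℕ), ∀ x ∈ U, 2 * ((n : ℂ) + 2) * a₁ x ≠ 0 := fun n x hx =>
    mul_ne_zero (mul_ne_zero two_ne_zero (by exact_mod_cast (n + 1).succ_ne_zero)) (ha₁ne x hx)
  have hsmooth : ∀ j, ContDiffOn ℝ (⊤ : ℕ∞) (transportCoeff a₀ a₁ j) U := by
    intro j
    induction j using Nat.strong_induction_on with
    | _ j ih =>
      match j, ih with
      | 0, _ => rwa [h0]
      | 1, _ => rwa [h1]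
      | n + 2, ih =>
        refine ContDiffOn.congr ?_ (transportCoeff_add_two hU a₀ a₁ n)
        simp only [div_eq_mul_inv]
        exact (ContDiffOn.transportSource hU n ih).neg.mul
          ((contDiffOn_const.mul ha₁).inv (hne n))
  refine ⟨transportCoeff a₀ a₁, ⟨h0, h1, fun j _ => hsmooth j, ?_⟩, ?_⟩
  · intro m hm x hx
    obtain ⟨n, rfl⟩ := Nat.exists_eq_add_of_le' hm
    rw [transport_eq_source_add, transportCoeff_add_two hU a₀ a₁ n hx, h1,
      mul_div_cancel₀ _ (hne n x hx), add_neg_cancel]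
  · intro b hb0 hb1 _ hb j hj
    clear hj
    induction j using Nat.strong_induction_on with
    | _ j ih =>
      match j, ih with
      | 0, _ => rw [h0, hb0]; exact eqOn_refl _ _
      | 1, _ => rw [h1, hb1]; exact eqOn_refl _ _
      | n + 2, ih =>
        intro x hx
        have hbx := hb (n + 1) (by omega) x hx
        rw [transport_eq_source_add, hb1] at hbx
        have hsrc := transportSource_eqOn hU n ih hx
        rw [transportCoeff_add_two hU a₀ a₁ n hx]
        beta_reduce
        rw [hsrc, div_eq_iff (hne n x hx)]
        linear_combination -hbx
end
end
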